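/- Let X, Y be compacta, L a compact Lawson lattice, and R, S ⊆ exp X × exp Y × L L-ambiguous representations. Define R∨S = {(A,B,α₁∨α₂) : (A,B,α₁) ∈ R, (A,B,α₂) ∈ S} and R∧S = R ∩ S. Then (R∨S)^⊣ = R^⊣ ∨ S^⊣ and (R∧S)^⊣ = R^⊣ ∧ S^⊣. -/

import Mathlib

open Set Topology

/-- The hyperspace `exp X` of all nonempty closed subsets of `X`. -/
structure Exp (X : Type*) [TopologicalSpace X] where
  carrier : Set X
  isClosed' : IsClosed carrier
  nonempty' : carrier.Nonempty

namespace Exp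

variable {X : Type*} [TopologicalSpace X]

/-- The Vietoris topology on `exp X`, generated by the subbase consisting of the sets
`⟨U⟩ = {F | F ⊆ U}` and `⟨X, U⟩ = {F | F ∩ U ≠ ∅}` for open `U ⊆ X`. -/
instance topologicalSpace : TopologicalSpace (Exp X) :=
  TopologicalSpace.generateFrom
    ({S | ∃ U : Set X, IsOpen U ∧ S = {F : Exp X | F.carrier ⊆ U}} ∪
     {S | ∃ U : Set X, IsOpen U ∧ S = {F : Exp X | (F.carrier ∩ U).Nonempty}})

/-- The whole space `X` as an element of `exp X`. -/
def univ (X : Type*) [TopologicalSpace X] [Nonempty X] : Exp X :=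
  ⟨Set.univ, isClosed_univ, Set.univ_nonempty⟩

/-- Union of two elements of `exp X`. -/
def union (F G : Exp X) : Exp X :=
  ⟨F.carrier ∪ G.carrier, F.isClosed'.union G.isClosed',
    Set.union_nonempty.mpr (Or.inl F.nonempty')⟩

end Exp

section AmbiguousRepresentations

variable {X Y Z : Type*} [TopologicalSpace X] [TopologicalSpace Y] [TopologicalSpace Z]

/-- An ambiguous representation between `X` and `Y`:
(a) antitone in the first argument and isotone in the second;
(b) `(A, Y) ∈ R` for all `A`;
(c) all sets `AR = {B | (A,B) ∈ R}` are closed in the Vietoris topology. -/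
def IsAmbRep [Nonempty Y] (R : Set (Exp X × Exp Y)) : Prop :=
  (∀ (A A' : Exp X) (B B' : Exp Y),
      (A, B) ∈ R → A'.carrier ⊆ A.carrier → B.carrier ⊆ B'.carrier → (A', B') ∈ R) ∧
  (∀ A : Exp X, (A, Exp.univ Y) ∈ R) ∧
  (∀ A : Exp X, IsClosed {B : Exp Y | (A, B) ∈ R})

/-- The relation `R^⊣ ⊆ exp Y × exp X`: `(B̃, Ã) ∈ R^⊣` iff for every `A ∈ exp X` with
`A ∩ Ã = ∅` there exists `B ∈ AR` with `B ∩ B̃ = ∅`. -/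
def sms (R : Set (Exp X × Exp Y)) : Set (Exp Y × Exp X) :=
  {p | ∀ A : Exp X, A.carrier ∩ p.2.carrier = ∅ →
      ∃ B : Exp Y, (A, B) ∈ R ∧ B.carrier ∩ p.1.carrier = ∅}

/-- A strict ambiguous representation: additionally all sets `RB = {A | (A,B) ∈ R}`
are closed. -/
def IsStrictAmbRep [Nonempty Y] (R : Set (Exp X × Exp Y)) : Prop :=
  IsAmbRep R ∧ ∀ B : Exp Y, IsClosed {A : Exp X | (A, B) ∈ R}

/-- An open ambiguous representation: strict, pseudo-invertible, and `R^⊣` is strict. -/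
def IsOpenAmbRep [Nonempty X] [Nonempty Y] (R : Set (Exp X × Exp Y)) : Prop :=
  IsStrictAmbRep R ∧ sms (sms R) = R ∧ IsStrictAmbRep (sms R)

/-- The composition `R ⊚ S`: `A (R ⊚ S)` is the closure of
`{C | ∃ B, (A,B) ∈ R ∧ (B,C) ∈ S}`. -/
def bcomp (R : Set (Exp X × Exp Y)) (S : Set (Exp Y × Exp Z)) : Set (Exp X × Exp Z) :=
  {p | p.2 ∈ closure {C : Exp Z | ∃ B : Exp Y, (p.1, B) ∈ R ∧ (B, C) ∈ S}}

/-- The relational composition of `R` and `S`. -/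
def rcomp (R : Set (Exp X × Exp Y)) (S : Set (Exp Y × Exp Z)) : Set (Exp X × Exp Z) :=
  {p | ∃ B : Exp Y, (p.1, B) ∈ R ∧ (B, p.2) ∈ S}

end AmbiguousRepresentations

section LFuzzy

variable {X Y : Type*} [TopologicalSpace X] [TopologicalSpace Y]
variable {L : Type*}

/-- `a` is way below `b`: for every nonempty directed set `D` with `b ≤ sup D` there is
`c ∈ D` with `a ≤ c`. -/
def WayBelow [CompleteLattice L] (a b : L) : Prop :=
  ∀ D : Set L, D.Nonempty → DirectedOn (· ≤ ·) D → b ≤ sSup D → ∃ c ∈ D, a ≤ c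

/-- An `L`-ambiguous representation between `X` and `Y`. -/
def IsLAmbRep [Nonempty Y] [CompleteLattice L] [TopologicalSpace L]
    (R : Set (Exp X × Exp Y × L)) : Prop :=
  (∀ (A A' : Exp X) (B B' : Exp Y) (α α' : L),
      (A, B, α) ∈ R → A'.carrier ⊆ A.carrier → B.carrier ⊆ B'.carrier → α' ≤ α →
        (A', B', α') ∈ R) ∧
  (∀ (A : Exp X) (B : Exp Y) (α β : L),
      (A, B, α) ∈ R → (A, B, β) ∈ R → (A, B, α ⊔ β) ∈ R) ∧
  (∀ (A : Exp X) (α : L), (A, Exp.univ Y, α) ∈ R) ∧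
  (∀ (A : Exp X) (B : Exp Y), (A, B, (⊥ : L)) ∈ R) ∧
  (∀ A : Exp X, IsClosed {q : Exp Y × L | (A, q.1, q.2) ∈ R})

/-- The `α`-cut of `R ⊆ exp X × exp Y × L`. -/
def lCut (R : Set (Exp X × Exp Y × L)) (α : L) : Set (Exp X × Exp Y) :=
  {p | (p.1, p.2, α) ∈ R}

/-- The relation `R^⊣ ⊆ exp Y × exp X × L`, defined cut-wise by
`(R^⊣)_α = ⋂_{β ≪ α} (R_β)^⊣`. -/
def smsL [CompleteLattice L] (R : Set (Exp X × Exp Y × L)) : Set (Exp Y × Exp X × L) :=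
  {q | ∀ β : L, WayBelow β q.2.2 → (q.1, q.2.1) ∈ sms (lCut R β)}

end LFuzzy

/-- The join `R ∨ S` of two `L`-ambiguous representations. -/
def lVee {X Y L : Type*} [TopologicalSpace X] [TopologicalSpace Y] [CompleteLattice L]
    (R S : Set (Exp X × Exp Y × L)) : Set (Exp X × Exp Y × L) :=
  {t | ∃ α₁ α₂ : L, (t.1, t.2.1, α₁) ∈ R ∧ (t.1, t.2.1, α₂) ∈ S ∧ t.2.2 = α₁ ⊔ α₂}

section CompactTopologicalLattice

variable {L : Type*} [CompleteLattice L] [TopologicalSpace L] [CompactSpace L] [T2Space L]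

/-- In a compact topological lattice, the supremum of a directed set lies in its closure. -/
theorem sSup_mem_closure_of_directedOn [TopologicalLattice L] {D : Set L} (hne : D.Nonempty)
    (hD : DirectedOn (· ≤ ·) D) : sSup D ∈ closure D := by
  have : Nonempty D := hne.to_subtype
  obtain ⟨c, hc⟩ := IsCompact.nonempty_iInter_of_directed_nonempty_isCompact_isClosed
    (fun d : D => closure (D ∩ Ici d.1))
    (by
      intro a b
      obtain ⟨e, he, hae, hbe⟩ := hD a.1 a.2 b.1 b.2
      exact ⟨⟨e, he⟩, closure_mono (inter_subset_inter_right _ (Ici_subset_Ici.2 hae)),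
        closure_mono (inter_subset_inter_right _ (Ici_subset_Ici.2 hbe))⟩)
    (fun d => ⟨d.1, subset_closure ⟨d.2, le_rfl⟩⟩)
    (fun d => isClosed_closure.isCompact) (fun d => isClosed_closure)
  rw [mem_iInter] at hc
  have hIci (d : L) : IsClosed (Ici d) := by
    have : Ici d = {x | d ⊓ x = d} := by ext x; simp
    rw [this]
    exact isClosed_eq (by fun_prop) (by fun_prop)
  have hIic (d : L) : IsClosed (Iic d) := by
    have : Iic d = {x | x ⊓ d = x} := by ext x; simp
    rw [this]
    exact isClosed_eq (by fun_prop) (by fun_prop)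
  have hcD : c ∈ closure D := by
    obtain ⟨d, hd⟩ := hne
    exact closure_mono inter_subset_left (hc ⟨d, hd⟩)
  have hcs : c = sSup D := by
    apply le_antisymm
    · exact closure_minimal (fun d hd => le_sSup hd) (hIic _) hcD
    · exact sSup_le fun d hd => closure_minimal inter_subset_right (hIci d) (hc ⟨d, hd⟩)
  exact hcs ▸ hcD

/-- In a compact topological lattice, the infimum of a filtered set lies in its closure. -/
theorem sInf_mem_closure_of_directedOn [TopologicalLattice L] {D : Set L} (hne : D.Nonempty)
    (hD : DirectedOn (· ≥ ·) D) : sInf D ∈ closure D := by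
  have : CompactSpace Lᵒᵈ := inferInstanceAs (CompactSpace L)
  have : T2Space Lᵒᵈ := inferInstanceAs (T2Space L)
  exact sSup_mem_closure_of_directedOn (L := Lᵒᵈ) (D := OrderDual.ofDual ⁻¹' D) hne hD

/-- A compact topological lattice with local bases of lower subsemilattices is continuous:
an element is below every upper bound of the elements way below it. -/
theorem le_of_forall_wayBelow_le [TopologicalLattice L]
    (hLow : ∀ x : L, ∀ N ∈ 𝓝 x, ∃ V ∈ 𝓝 x, V ⊆ N ∧ ∀ a ∈ V, ∀ b ∈ V, a ⊓ b ∈ V)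
    {x u : L} (h : ∀ m, WayBelow m x → m ≤ u) : x ≤ u := by
  by_contra hxu
  have hopen : {y : L | y ⊓ u ≠ y} ∈ 𝓝 x :=
    (isOpen_ne_fun (by fun_prop) (by fun_prop)).mem_nhds fun e => hxu (inf_eq_left.1 e)
  obtain ⟨N, hN, hNc, hNu⟩ := exists_mem_nhds_isClosed_subset hopen
  obtain ⟨V, hV, hVN, hVinf⟩ := hLow x N hN
  have hm : sInf V ∈ N := closure_minimal hVN hNc <|
    sInf_mem_closure_of_directedOn ⟨x, mem_of_mem_nhds hV⟩
      fun a ha b hb => ⟨a ⊓ b, hVinf a ha b hb, inf_le_left, inf_le_right⟩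
  refine hNu hm (inf_eq_left.2 (h _ fun D hne hD hx => ?_))
  have hcont : Continuous fun d : L => x ⊓ d := by fun_prop
  have hxV : (fun d : L => x ⊓ d) ⁻¹' V ∈ 𝓝 (sSup D) :=
    hcont.continuousAt (by simpa [inf_eq_left.2 hx] using hV)
  obtain ⟨d, hdV, hd⟩ := mem_closure_iff_nhds.1 (sSup_mem_closure_of_directedOn hne hD) _ hxV
  exact ⟨d, hd, (sInf_le (s := V) hdV).trans inf_le_right⟩

/-- In a compact topological lattice, binary joins commute with filtered infima. -/
theorem le_iInf_sup_iInf_of_directed [TopologicalLattice L] {ι : Type*} {f g : ι → L}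
    (hfg : Directed (· ≥ ·) fun i => (f i, g i)) {a : L} (h : ∀ i, a ≤ f i ⊔ g i) :
    a ≤ (⨅ i, f i) ⊔ ⨅ i, g i := by
  rcases isEmpty_or_nonempty ι with hι | hι
  · simp [iInf_of_empty]
  have : ContinuousInf (L × L) := ⟨by
    change Continuous fun p : (L × L) × (L × L) => (p.1.1 ⊓ p.2.1, p.1.2 ⊓ p.2.2)
    fun_prop⟩
  have : ContinuousSup (L × L) := ⟨by
    change Continuous fun p : (L × L) × (L × L) => (p.1.1 ⊔ p.2.1, p.1.2 ⊔ p.2.2)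
    fun_prop⟩
  have : TopologicalLattice (L × L) := ⟨⟩
  have hmem := sInf_mem_closure_of_directedOn (range_nonempty fun i => (f i, g i))
    hfg.directedOn_range
  have hcl : IsClosed {p : L × L | a ⊓ (p.1 ⊔ p.2) = a} :=
    isClosed_eq (by fun_prop) (by fun_prop)
  have hsub : (range fun i => (f i, g i)) ⊆ {p : L × L | a ⊓ (p.1 ⊔ p.2) = a} :=
    range_subset_iff.2 fun i => inf_eq_left.2 (h i)
  have hinf := closure_minimal hsub hcl hmem
  rw [sInf_range, mem_ofPred_eq, Prod.fst_iInf, Prod.snd_iInf] at hinf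
  exact inf_eq_left.1 hinf

end CompactTopologicalLattice

section Pseudoinverse

variable {X Y L : Type*} [TopologicalSpace X] [TopologicalSpace Y] [CompleteLattice L]

/-- The algebraic part of the definition of an `L`-ambiguous representation: monotonicity,
closedness under joins of degrees, and triviality at the bottom degree. -/
structure IsMonotoneLRel (R : Set (Exp X × Exp Y × L)) : Prop where
  mono : ∀ {A A' : Exp X} {B B' : Exp Y} {α α' : L}, (A, B, α) ∈ R →
    A'.carrier ⊆ A.carrier → B.carrier ⊆ B'.carrier → α' ≤ α → (A', B', α') ∈ R
  sup : ∀ {A : Exp X} {B : Exp Y} {α β : L}, (A, B, α) ∈ R → (A, B, β) ∈ R → (A, B, α ⊔ β) ∈ R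
  bot : ∀ (A : Exp X) (B : Exp Y), (A, B, (⊥ : L)) ∈ R

theorem IsLAmbRep.isMonotoneLRel [Nonempty Y] [TopologicalSpace L]
    {R : Set (Exp X × Exp Y × L)} (hR : IsLAmbRep R) : IsMonotoneLRel R where
  mono := hR.1 _ _ _ _ _ _
  sup := hR.2.1 _ _ _ _
  bot := hR.2.2.2.1

theorem IsMonotoneLRel.lVee (hdistrib : ∀ a b c : L, a ⊓ (b ⊔ c) = (a ⊓ b) ⊔ (a ⊓ c))
    {R S : Set (Exp X × Exp Y × L)} (hR : IsMonotoneLRel R) (hS : IsMonotoneLRel S) :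
    IsMonotoneLRel (lVee R S) where
  mono := by
    rintro A A' B B' α α' ⟨a, b, ha, hb, rfl⟩ hA hB hα
    exact ⟨α' ⊓ a, α' ⊓ b, hR.mono ha hA hB inf_le_right, hS.mono hb hA hB inf_le_right,
      by rw [← hdistrib, inf_eq_left.2 hα]⟩
  sup := by
    rintro A B α β ⟨a, b, ha, hb, rfl⟩ ⟨c, d, hc, hd, rfl⟩
    exact ⟨a ⊔ c, b ⊔ d, hR.sup ha hc, hS.sup hb hd, sup_sup_sup_comm _ _ _ _⟩
  bot A B := ⟨⊥, ⊥, hR.bot A B, hS.bot A B, by simp⟩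

/-- The degrees to which `A` is related by `R` to some set disjoint from `B'`. -/
def disjointDegrees (R : Set (Exp X × Exp Y × L)) (B' : Exp Y) (A : Exp X) : Set L :=
  {β | ∃ B : Exp Y, (A, B, β) ∈ R ∧ B.carrier ∩ B'.carrier = ∅}

theorem Exp.union_inter_eq_empty {B C D : Exp Y} (hB : B.carrier ∩ D.carrier = ∅)
    (hC : C.carrier ∩ D.carrier = ∅) : (B.union C).carrier ∩ D.carrier = ∅ := by
  simp [Exp.union, union_inter_distrib_right, hB, hC]

theorem IsMonotoneLRel.directedOn_disjointDegrees {R : Set (Exp X × Exp Y × L)}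
    (hR : IsMonotoneLRel R) (B' : Exp Y) (A : Exp X) :
    DirectedOn (· ≤ ·) (disjointDegrees R B' A) := by
  rintro a ⟨B, hB, hBd⟩ b ⟨C, hC, hCd⟩
  exact ⟨a ⊔ b, ⟨B.union C, hR.sup (hR.mono hB subset_rfl subset_union_left le_rfl)
    (hR.mono hC subset_rfl subset_union_right le_rfl), Exp.union_inter_eq_empty hBd hCd⟩,
    le_sup_left, le_sup_right⟩

theorem IsMonotoneLRel.antitone_sSup_disjointDegrees {R : Set (Exp X × Exp Y × L)}
    (hR : IsMonotoneLRel R) (B' : Exp Y) {A A' : Exp X} (h : A.carrier ⊆ A'.carrier) :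
    sSup (disjointDegrees R B' A') ≤ sSup (disjointDegrees R B' A) :=
  by
  refine sSup_le_sSup ?_
  rintro β ⟨B, hB, hBd⟩
  exact ⟨B, hR.mono hB h subset_rfl le_rfl, hBd⟩

theorem IsMonotoneLRel.mem_smsL_iff [TopologicalSpace L] [CompactSpace L] [T2Space L]
    [TopologicalLattice L]
    (hLow : ∀ x : L, ∀ N ∈ 𝓝 x, ∃ V ∈ 𝓝 x, V ⊆ N ∧ ∀ a ∈ V, ∀ b ∈ V, a ⊓ b ∈ V)
    {R : Set (Exp X × Exp Y × L)} (hR : IsMonotoneLRel R) {B' : Exp Y} {A' : Exp X} {α : L} :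
    (B', A', α) ∈ smsL R ↔ ∀ A : Exp X, A.carrier ∩ A'.carrier = ∅ →
      (∃ B : Exp Y, B.carrier ∩ B'.carrier = ∅) ∧ α ≤ sSup (disjointDegrees R B' A) := by
  constructor
  · intro h A hA
    constructor
    · obtain ⟨B, -, hB⟩ := h ⊥ (fun D hD _ _ => ⟨hD.some, hD.some_mem, bot_le⟩) A hA
      exact ⟨B, hB⟩
    · exact le_of_forall_wayBelow_le hLow fun β hβ => le_sSup (h β hβ A hA)
  · intro h β hβ A hA
    obtain ⟨⟨B, hB⟩, hα⟩ := h A hA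
    have hne : (disjointDegrees R B' A).Nonempty := ⟨⊥, B, hR.bot A B, hB⟩
    obtain ⟨γ, ⟨C, hC, hCd⟩, hβγ⟩ := hβ _ hne (hR.directedOn_disjointDegrees B' A) hα
    exact ⟨C, hR.mono hC subset_rfl subset_rfl hβγ, hCd⟩

theorem IsMonotoneLRel.sSup_disjointDegrees_lVee {R S : Set (Exp X × Exp Y × L)}
    (hR : IsMonotoneLRel R) (hS : IsMonotoneLRel S) (B' : Exp Y) (A : Exp X) :
    sSup (disjointDegrees (_root_.lVee R S) B' A) =
      sSup (disjointDegrees R B' A) ⊔ sSup (disjointDegrees S B' A) := by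
  apply le_antisymm
  · refine sSup_le ?_
    rintro _ ⟨B, ⟨a, b, ha, hb, rfl⟩, hBd⟩
    exact sup_le_sup (le_sSup ⟨B, ha, hBd⟩) (le_sSup ⟨B, hb, hBd⟩)
  · refine sup_le (sSup_le_sSup ?_) (sSup_le_sSup ?_)
    · rintro a ⟨B, ha, hBd⟩
      exact ⟨B, ⟨a, ⊥, ha, hS.bot A B, by simp⟩, hBd⟩
    · rintro a ⟨B, ha, hBd⟩
      exact ⟨B, ⟨⊥, a, hR.bot A B, ha, by simp⟩, hBd⟩

theorem smsL_lVee [TopologicalSpace L] [CompactSpace L] [T2Space L] [TopologicalLattice L]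
    (hdistrib : ∀ a b c : L, a ⊓ (b ⊔ c) = (a ⊓ b) ⊔ (a ⊓ c))
    (hLow : ∀ x : L, ∀ N ∈ 𝓝 x, ∃ V ∈ 𝓝 x, V ⊆ N ∧ ∀ a ∈ V, ∀ b ∈ V, a ⊓ b ∈ V)
    {R S : Set (Exp X × Exp Y × L)} (hR : IsMonotoneLRel R) (hS : IsMonotoneLRel S) :
    smsL (lVee R S) = lVee (smsL R) (smsL S) := by
  have hRS := hR.lVee hdistrib hS
  ext ⟨B', A', α⟩
  rw [hRS.mem_smsL_iff hLow]
  constructor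
  · intro h
    let ι := {A : Exp X // A.carrier ∩ A'.carrier = ∅}
    let f : ι → L := fun A => sSup (disjointDegrees R B' A.1)
    let g : ι → L := fun A => sSup (disjointDegrees S B' A.1)
    have hdir : Directed (· ≥ ·) fun A : ι => (f A, g A) := fun A C =>
      ⟨⟨A.1.union C.1, Exp.union_inter_eq_empty A.2 C.2⟩,
        ⟨hR.antitone_sSup_disjointDegrees B' subset_union_left,
          hS.antitone_sSup_disjointDegrees B' subset_union_left⟩,
        ⟨hR.antitone_sSup_disjointDegrees B' subset_union_right,
          hS.antitone_sSup_disjointDegrees B' subset_union_right⟩⟩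
    have hα : α ≤ (⨅ A, f A) ⊔ ⨅ A, g A := le_iInf_sup_iInf_of_directed hdir fun A => by
      simpa only [hR.sSup_disjointDegrees_lVee hS] using (h A.1 A.2).2
    refine ⟨α ⊓ ⨅ A, f A, α ⊓ ⨅ A, g A, (hR.mem_smsL_iff hLow).2 fun A hA => ?_,
      (hS.mem_smsL_iff hLow).2 fun A hA => ?_, ?_⟩
    · exact ⟨(h A hA).1, inf_le_right.trans (iInf_le f ⟨A, hA⟩)⟩
    · exact ⟨(h A hA).1, inf_le_right.trans (iInf_le g ⟨A, hA⟩)⟩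
    · rw [← hdistrib, inf_eq_left.2 hα]
  · rintro ⟨a, b, ha, hb, rfl⟩ A hA
    have ha' := (hR.mem_smsL_iff hLow).1 ha A hA
    have hb' := (hS.mem_smsL_iff hLow).1 hb A hA
    rw [hR.sSup_disjointDegrees_lVee hS]
    exact ⟨ha'.1, sup_le_sup ha'.2 hb'.2⟩

theorem smsL_inter {R S : Set (Exp X × Exp Y × L)} (hR : IsMonotoneLRel R)
    (hS : IsMonotoneLRel S) : smsL (R ∩ S) = smsL R ∩ smsL S := by
  ext ⟨B', A', α⟩
  constructor
  · intro h
    constructor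
    · intro β hβ A hA
      obtain ⟨B, hB, hBd⟩ := h β hβ A hA
      exact ⟨B, hB.1, hBd⟩
    · intro β hβ A hA
      obtain ⟨B, hB, hBd⟩ := h β hβ A hA
      exact ⟨B, hB.2, hBd⟩
  · rintro ⟨h₁, h₂⟩ β hβ A hA
    obtain ⟨B, hB, hBd⟩ := h₁ β hβ A hA
    obtain ⟨C, hC, hCd⟩ := h₂ β hβ A hA
    exact ⟨B.union C, ⟨hR.mono hB subset_rfl subset_union_left le_rfl,
      hS.mono hC subset_rfl subset_union_right le_rfl⟩, Exp.union_inter_eq_empty hBd hCd⟩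

end Pseudoinverse

/-- `(R ∨ S)^⊣ = R^⊣ ∨ S^⊣` and `(R ∧ S)^⊣ = R^⊣ ∧ S^⊣` for `L`-ambiguous
representations over compacta and a compact Lawson lattice `L`. -/
theorem statement19 {X Y L : Type*}
    [TopologicalSpace X] [CompactSpace X] [T2Space X] [Nonempty X]
    [TopologicalSpace Y] [CompactSpace Y] [T2Space Y] [Nonempty Y]
    [CompleteLattice L] [TopologicalSpace L] [CompactSpace L] [T2Space L]
    [TopologicalLattice L]
    (hdistrib : ∀ a b c : L, a ⊓ (b ⊔ c) = (a ⊓ b) ⊔ (a ⊓ c))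
    (hLawsonUp : ∀ x : L, ∀ N ∈ 𝓝 x, ∃ V ∈ 𝓝 x, V ⊆ N ∧ ∀ a ∈ V, ∀ b ∈ V, a ⊔ b ∈ V)
    (hLawsonLow : ∀ x : L, ∀ N ∈ 𝓝 x, ∃ V ∈ 𝓝 x, V ⊆ N ∧ ∀ a ∈ V, ∀ b ∈ V, a ⊓ b ∈ V)
    (R S : Set (Exp X × Exp Y × L)) (hR : IsLAmbRep R) (hS : IsLAmbRep S) :
    smsL (lVee R S) = lVee (smsL R) (smsL S) ∧ smsL (R ∩ S) = smsL R ∩ smsL S := by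
  exact ⟨smsL_lVee hdistrib hLawsonLow hR.isMonotoneLRel hS.isMonotoneLRel,
    smsL_inter hR.isMonotoneLRel hS.isMonotoneLRel⟩
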